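/- arXiv:1601.01508 — 2 statements merged into one kernel-verified Lean document; each statement's English description precedes it below -/
import Mathlib

section
/- Let k be a field of characteristic zero, let f_1,…,f_m ∈ k[x_1,…,x_n] be polynomials with 1 ≤ m ≤ n, and let g ∈ k[x_1,…,x_n] be an irreducible polynomial. If g divides dgcd(f_1,…,f_m), then g divides w(f_1,…,f_m) for some irreducible polynomial w ∈ k[x_1,…,x_m]. -/
open MvPolynomial

/-- The Jacobian determinant of `f₁, …, f_m` with respect to the variables
`x_{i 1}, …, x_{i m}`. -/
noncomputable def jacDet {k : Type*} [Field k] {m n : ℕ}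
    (f : Fin m → MvPolynomial (Fin n) k) (i : Fin m → Fin n) : MvPolynomial (Fin n) k :=
  Matrix.det (Matrix.of fun j l => pderiv (i l) (f j))

/-- `d` is a greatest common divisor (in the UFD `k[x₁,…,xₙ]`) of all Jacobian
determinants `jac^{f₁,…,f_m}_{x_{i₁},…,x_{i_m}}`, `1 ≤ i₁ < … < i_m ≤ n`;
strictly increasing sequences `i₁ < … < i_m` are encoded as strictly monotone
maps `Fin m → Fin n`.  (Note that this forces `d = 0` when all the Jacobian
determinants vanish.) -/
def IsDgcd {k : Type*} [Field k] {m n : ℕ}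
    (f : Fin m → MvPolynomial (Fin n) k) (d : MvPolynomial (Fin n) k) : Prop :=
  (∀ i : Fin m → Fin n, StrictMono i → d ∣ jacDet f i) ∧
  ∀ e : MvPolynomial (Fin n) k, (∀ i : Fin m → Fin n, StrictMono i → e ∣ jacDet f i) → e ∣ d


set_option linter.style.haveILetI false

lemma aux_lift {P L B : Type*} [CommRing P] [CommRing L] [CommRing B] [Algebra P L]
    [Algebra.FormallySmooth P L] (π : B →+* L) (hs : Function.Surjective π)
    (hn : IsNilpotent (RingHom.ker π)) (σ : P →+* B) (h : π.comp σ = algebraMap P L) :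
    ∃ φ : L →+* B, (∀ x, π (φ x) = x) ∧ ∀ p, φ (algebraMap P L p) = σ p := by
  let : Algebra P B := σ.toAlgebra
  let g : B →ₐ[P] L := { π with commutes' := fun r => RingHom.congr_fun h r }
  refine ⟨(Algebra.FormallySmooth.liftOfSurjective (AlgHom.id P L) g hs hn : L →ₐ[P] B), ?_, ?_⟩
  · intro x
    exact Algebra.FormallySmooth.liftOfSurjective_apply (AlgHom.id P L) g hs hn x
  · intro p
    exact AlgHom.commutes _ p

lemma aux_smooth {k L : Type*} [Field k] [CharZero k] [Field L] [Algebra k L]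
    [Algebra.EssFiniteType k L] {m : ℕ} [Algebra (MvPolynomial (Fin m) k) L]
    [IsScalarTower k (MvPolynomial (Fin m) k) L]
    (hv : Function.Injective (algebraMap (MvPolynomial (Fin m) k) L)) :
    Algebra.FormallySmooth (MvPolynomial (Fin m) k) L := by
  let P := MvPolynomial (Fin m) k
  have : FaithfulSMul P L := (faithfulSMul_iff_algebraMap_injective P L).2 hv
  let : Algebra (FractionRing P) L := FractionRing.liftAlgebra P L
  have : IsScalarTower P (FractionRing P) L := inferInstance
  have : IsScalarTower k (FractionRing P) L := IsScalarTower.of_algebraMap_eq fun x => by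
    rw [IsScalarTower.algebraMap_apply k P L, IsScalarTower.algebraMap_apply k P (FractionRing P),
      ← IsScalarTower.algebraMap_apply P (FractionRing P) L]
  have : CharZero (FractionRing P) := charZero_of_injective_algebraMap
    (FaithfulSMul.algebraMap_injective k (FractionRing P))
  have : Algebra.EssFiniteType (FractionRing P) L := Algebra.EssFiniteType.of_comp k _ L
  have : Algebra.FormallySmooth (FractionRing P) L := Algebra.FormallySmooth.of_perfectField
  have : Algebra.FormallySmooth P (FractionRing P) :=
    Algebra.FormallySmooth.of_isLocalization (nonZeroDivisors P)
  exact Algebra.FormallySmooth.comp P (FractionRing P) L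

lemma aux_ext {k L : Type*} [Field k] [CharZero k] [Field L] [Algebra k L]
    [Algebra.EssFiniteType k L] {m : ℕ} (v : Fin m → L) (hv : AlgebraicIndependent k v)
    (c : Fin m → L) :
    ∃ D : Derivation k L L, ∀ j, D (v j) = c j := by
  let : Algebra (MvPolynomial (Fin m) k) L := (aeval v : _ →ₐ[k] L).toRingHom.toAlgebra
  have : IsScalarTower k (MvPolynomial (Fin m) k) L :=
    IsScalarTower.of_algebraMap_eq fun x => ((aeval v : _ →ₐ[k] L).commutes x).symm
  have := aux_smooth (k := k) (L := L) (m := m) hv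
  let π : TrivSqZeroExt L L →ₐ[k] L := TrivSqZeroExt.fstHom k L L
  let σ : MvPolynomial (Fin m) k →ₐ[k] TrivSqZeroExt L L :=
    aeval fun j => TrivSqZeroExt.inl (v j) + TrivSqZeroExt.inr (c j)
  have hπσ : π.comp σ = aeval v := by
    ext j
    simp [π, σ]
  obtain ⟨φ, h1, h2⟩ := aux_lift (P := MvPolynomial (Fin m) k) (L := L) π.toRingHom
    TrivSqZeroExt.fst_surjective
    ⟨2, by
      rw [Ideal.zero_eq_bot, eq_bot_iff, pow_two, Ideal.mul_le]
      intro a ha b hb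
      have ha' : a.fst = 0 := ha
      have hb' : b.fst = 0 := hb
      rw [Ideal.mem_bot]
      ext <;> simp [ha', hb']⟩ σ.toRingHom
    (RingHom.ext fun x => AlgHom.congr_fun hπσ x)
  have h1' : ∀ x, (φ x).fst = x := h1
  have hk : ∀ r : k, φ (algebraMap k L r) = TrivSqZeroExt.inl (algebraMap k L r) := by
    intro r
    have := h2 (C r)
    have e : algebraMap (MvPolynomial (Fin m) k) L (C r) = algebraMap k L r :=
      (aeval v : _ →ₐ[k] L).commutes r
    rw [e] at this
    rw [this]
    exact σ.commutes r
  refine ⟨Derivation.mk' { toFun := fun x => (φ x).snd, map_add' := fun x y => by simp,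
                           map_smul' := fun r x => by
                            simp [Algebra.smul_def, hk] } ?_, ?_⟩
  · intro a b
    simp [h1', mul_comm]
  · intro j
    have := h2 (X j)
    have e : algebraMap (MvPolynomial (Fin m) k) L (X j) = v j := aeval_X v j
    rw [e] at this
    change (φ (v j)).snd = c j
    rw [this]
    simp [σ]

lemma aux_minor {L : Type*} [Field L] {m n : ℕ} (A : Matrix (Fin m) (Fin n) L)
    (C : Matrix (Fin n) (Fin m) L) (h : A * C = 1)
    (hz : ∀ i : Fin m → Fin n, StrictMono i → (A.submatrix id i).det = 0) : False := by
  have key : ∀ r : Fin m → Fin n, (A.submatrix id r).det = 0 := by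
    intro r
    by_cases hr : Function.Injective r
    · have hs : StrictMono (r ∘ Tuple.sort r) :=
        (Tuple.monotone_sort r).strictMono_of_injective (hr.comp (Tuple.sort r).injective)
      have := hz _ hs
      have e : A.submatrix id (r ∘ Tuple.sort r) = (A.submatrix id r).submatrix id (Tuple.sort r) := rfl
      rw [e, Matrix.det_permute'] at this
      rcases mul_eq_zero.1 this with h | h
      · exfalso
        rcases Int.units_eq_one_or (Equiv.Perm.sign (Tuple.sort r)) with h' | h' <;> simp [h'] at h
      · exact h
    · rw [Function.Injective] at hr
      push Not at hr
      obtain ⟨a, b, hab, hne⟩ := hr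
      exact Matrix.det_zero_of_column_eq hne (fun i => by simp [hab])
  have : (A * C).det = 0 := by
    rw [← Matrix.det_transpose]
    have e : (A * C).transpose = fun j => ∑ l, C l j • (fun i => A i l) := by
      ext j i
      simp [Matrix.mul_apply, Finset.sum_apply, mul_comm]
    rw [e]
    change Matrix.detRowAlternating.toMultilinearMap _ = 0
    rw [MultilinearMap.map_sum]
    refine Finset.sum_eq_zero fun r _ => ?_
    rw [MultilinearMap.map_smul_univ]
    have := key r
    rw [← Matrix.det_transpose] at this
    change _ • Matrix.det (A.submatrix id r).transpose = 0
    rw [this, smul_zero]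
  rw [h, Matrix.det_one] at this
  exact one_ne_zero this

lemma aux_chain {k L : Type*} [Field k] [Field L] [Algebra k L] {n : ℕ}
    (ρ : MvPolynomial (Fin n) k →ₐ[k] L) (D : Derivation k L L) (p : MvPolynomial (Fin n) k) :
    D (ρ p) = ∑ l, ρ (pderiv l p) * D (ρ (X l)) := by
  induction p using MvPolynomial.induction_on with
  | C a =>
    have : ρ (C a) = algebraMap k L a := ρ.commutes a
    simp [this]
  | add p q hp hq => simp [hp, hq, add_mul, Finset.sum_add_distrib]
  | mul_X p i hp =>
    simp only [map_mul, Derivation.leibniz, hp, pderiv_X, smul_eq_mul, map_add, add_mul,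
      Finset.sum_add_distrib]
    congr 1
    · rw [Finset.sum_eq_single i]
      · simp
      · intro b _ hb
        simp [Pi.single_apply, hb.symm]
      · simp
    · rw [Finset.mul_sum]
      exact Finset.sum_congr rfl fun l _ => by ring

theorem statement7 {k : Type*} [Field k] [CharZero k] {m n : ℕ}
    (hm : 1 ≤ m) (hmn : m ≤ n)
    (f : Fin m → MvPolynomial (Fin n) k)
    (g : MvPolynomial (Fin n) k) (hg : Irreducible g)
    (d : MvPolynomial (Fin n) k) (hd : IsDgcd f d)
    (hdvd : g ∣ d) :
    ∃ w : MvPolynomial (Fin m) k, Irreducible w ∧ g ∣ aeval f w := by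
  have hp : Prime g := hg.prime
  let I := Ideal.span {g}
  have : I.IsPrime := (Ideal.span_singleton_prime hp.ne_zero).2 hp
  let A := MvPolynomial (Fin n) k ⧸ I
  let L := FractionRing A
  have : Algebra.FiniteType k A := inferInstance
  have : Algebra.EssFiniteType A L := Algebra.EssFiniteType.of_isLocalization L (nonZeroDivisors A)
  have : Algebra.EssFiniteType k L := Algebra.EssFiniteType.comp k A L
  let ρ : MvPolynomial (Fin n) k →ₐ[k] L :=
    (IsScalarTower.toAlgHom k A L).comp (Ideal.Quotient.mkₐ k I)
  have hρ : ∀ p, ρ p = 0 ↔ g ∣ p := by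
    intro p
    change algebraMap A L (Ideal.Quotient.mk I p) = 0 ↔ _
    rw [FaithfulSMul.algebraMap_eq_zero_iff, Ideal.Quotient.eq_zero_iff_mem,
      Ideal.mem_span_singleton]
  have hdep : ¬ AlgebraicIndependent k (fun j => ρ (f j)) := by
    intro hv
    choose D hD using fun i : Fin m => aux_ext _ hv (Pi.single i 1)
    refine aux_minor (Matrix.of fun j l => ρ (pderiv l (f j)))
      (Matrix.of fun l i => D i (ρ (X l))) ?_ ?_
    · ext j i
      rw [Matrix.mul_apply]
      have := aux_chain ρ (D i) (f j)
      rw [hD] at this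
      simp only [Matrix.of_apply]
      rw [← this, Matrix.one_apply, Pi.single_apply]
    · intro i hi
      have h := (hρ _).2 (hdvd.trans (hd.1 i hi))
      rw [jacDet, AlgHom.map_det] at h
      exact h
  rw [algebraicIndependent_iff] at hdep
  push Not at hdep
  obtain ⟨w, hw, hw0⟩ := hdep
  have hcomp : ∀ q : MvPolynomial (Fin m) k, aeval (fun j => ρ (f j)) q = ρ (aeval f q) := by
    intro q
    exact (MvPolynomial.comp_aeval_apply f ρ q).symm
  clear hdvd hd
  induction w using WfDvdMonoid.induction_on_irreducible with
  | zero => exact absurd rfl hw0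
  | unit u hu =>
    exact absurd hw (hu.map _).ne_zero
  | mul a i ha hi ih =>
    rw [map_mul] at hw
    rcases mul_eq_zero.1 hw with h | h
    · exact ⟨i, hi, (hρ _).1 (by rw [← hcomp, h])⟩
    · exact ih h ha
end

section
/- Let k be a field of characteristic zero and let f ∈ k[x_1,…,x_n]. If the greatest common divisor of the partial derivatives ∂f/∂x_1, …, ∂f/∂x_n is a nonzero element of k, then the subalgebra k[f] is algebraically closed in k[x_1,…,x_n]; equivalently, k[f] is the ring of constants of some k-derivation of k[x_1,…,x_n]. -/
open MvPolynomial

theorem aux_chain_s18 {k A σ : Type*} [Field k] [CommRing A] [Algebra k A] [Fintype σ]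
    (E : Derivation k A A) (y : σ → A) (P : MvPolynomial σ k) :
    E (aeval y P) = ∑ j, aeval y (pderiv j P) * E (y j) := by
  classical
  induction P using MvPolynomial.induction_on with
  | C c => simp
  | add p q hp hq => simp [hp, hq, add_mul, Finset.sum_add_distrib]
  | mul_X p i hp =>
    simp only [map_mul, aeval_X, Derivation.leibniz, smul_eq_mul, hp, pderiv_X, map_add, add_mul,
      Finset.sum_add_distrib, Finset.mul_sum]
    congr 1
    · simp [Pi.single_apply, apply_ite]
    · exact Finset.sum_congr rfl fun j _ => by ring

theorem aux_deg {k σ : Type*} [Field k] (i : σ) (P : MvPolynomial σ k)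
    (h : pderiv i P ≠ 0) : (pderiv i P).totalDegree < P.totalDegree := by
  obtain ⟨m, hm, hd⟩ := Finset.exists_mem_eq_sup _ (support_nonempty.2 h)
    (fun s : σ →₀ ℕ => s.sum fun _ e => e)
  rw [totalDegree, hd]
  rw [mem_support_iff, coeff_pderiv] at hm
  have h1 := le_totalDegree (mem_support_iff.2 (left_ne_zero_of_mul hm))
  rw [Finsupp.sum_add_index' (by simp) (by simp), Finsupp.sum_single_index rfl] at h1
  exact h1

theorem aux_const {k σ : Type*} [Field k] [CharZero k] (P : MvPolynomial σ k)
    (h : ∀ i, pderiv i P = 0) : ∃ c, P = C c := by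
  classical
  refine ⟨coeff 0 P, ?_⟩
  ext m
  rw [coeff_C]
  split_ifs with h0
  · rw [h0]
  · obtain ⟨i, hi⟩ : ∃ i, m i ≠ 0 := by
      by_contra! hc
      exact h0 (by ext i; simp [hc])
    have := congrArg (coeff (m - Finsupp.single i 1)) (h i)
    rw [coeff_pderiv, coeff_zero] at this
    have e : m - Finsupp.single i 1 + Finsupp.single i 1 = m := by
      apply tsub_add_cancel_of_le
      simpa [Finsupp.single_le_iff] using Nat.one_le_iff_ne_zero.2 hi
    rw [e] at this
    rcases mul_eq_zero.1 this with h | h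
    · exact h
    · exfalso; exact_mod_cast h

theorem aux_eval {k A B : Type*} [Field k] [CommRing A] [Algebra k A] [CommRing B]
    (E : Derivation k A A) (φ : B →+* A) (a : A) (p : Polynomial B) :
    E (p.eval₂ φ a) = (p.sum fun j c => E (φ c) * a ^ j) + p.derivative.eval₂ φ a * E a := by
  induction p using Polynomial.induction_on' with
  | add p q hp hq =>
    rw [Polynomial.sum_add_index _ _ _ (by simp) (by simp [add_mul])]
    simp [hp, hq, add_mul]; ring
  | monomial n c =>
    rw [Polynomial.sum_monomial_index _ _ (by simp)]
    simp [Polynomial.derivative_monomial, Polynomial.eval₂_monomial, Derivation.leibniz_pow]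
    ring

theorem aux_min {k A B : Type*} [Field k] [CommRing A] [IsDomain A] [Algebra k A] [CommRing B]
    [IsDomain B] [CharZero B]
    (E : Derivation k A A) (φ : B →+* A) (hφ : Function.Injective φ) (a : A) (p : Polynomial B)
    (h0 : p ≠ 0) (hp : p.eval₂ φ a = 0)
    (hm : ∀ q : Polynomial B, q ≠ 0 → q.eval₂ φ a = 0 → p.natDegree ≤ q.natDegree)
    (hE : ∀ j, φ p.leadingCoeff * E (φ (p.coeff j)) = φ (p.coeff j) * E (φ p.leadingCoeff)) :
    E a = 0 := by
  have h1 := aux_eval E φ a p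
  rw [hp, map_zero] at h1
  have h2 : φ p.leadingCoeff * (p.sum fun j c => E (φ c) * a ^ j) = 0 := by
    rw [Polynomial.sum, Finset.mul_sum]
    have : ∑ j ∈ p.support, φ p.leadingCoeff * (E (φ (p.coeff j)) * a ^ j)
        = E (φ p.leadingCoeff) * p.eval₂ φ a := by
      rw [Polynomial.eval₂_eq_sum, Polynomial.sum, Finset.mul_sum]
      refine Finset.sum_congr rfl fun j _ => ?_
      linear_combination a ^ j * hE j
    rw [this, hp, mul_zero]
  have hl : φ p.leadingCoeff ≠ 0 := by
    rw [Ne, map_eq_zero_iff φ hφ]; simpa using h0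
  rw [(mul_eq_zero.1 h2).resolve_left hl, zero_add, eq_comm, mul_eq_zero] at h1
  refine h1.resolve_left fun h3 => ?_
  have hdeg : p.natDegree ≠ 0 := by
    intro hd
    rw [Polynomial.eq_C_of_natDegree_eq_zero hd, Polynomial.eval₂_C, map_eq_zero_iff φ hφ] at hp
    exact h0 (by rw [Polynomial.eq_C_of_natDegree_eq_zero hd, hp, map_zero])
  have h4 : p.derivative ≠ 0 := fun h => hdeg (Polynomial.derivative_eq_zero.1 h)
  exact absurd (hm _ h4 h3) (not_le.2 (Polynomial.natDegree_derivative_lt hdeg))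

theorem aux_min2 {k A B : Type*} [Field k] [CommRing A] [IsDomain A] [Algebra k A] [CommRing B]
    (d : Derivation k A A) (φ : B →+* A) (δ : B →+ B) (g : A) (hg : g ≠ 0)
    (hd : ∀ b, d (φ b) = g * φ (δ b)) (a : A) (ha : d a = 0) (p : Polynomial B)
    (hp : p.eval₂ φ a = 0)
    (hm : ∀ q : Polynomial B, q ≠ 0 → q.eval₂ φ a = 0 → p.natDegree ≤ q.natDegree) (j : ℕ) :
    p.leadingCoeff * δ (p.coeff j) = p.coeff j * δ p.leadingCoeff := by
  have h1 := aux_eval d φ a p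
  rw [hp, map_zero, ha, mul_zero, add_zero] at h1
  set r : Polynomial B := ∑ i ∈ p.support, Polynomial.monomial i (δ (p.coeff i)) with hr
  have hrc : ∀ j, r.coeff j = δ (p.coeff j) := by
    intro j
    simp only [hr, Polynomial.finsetSum_coeff, Polynomial.coeff_monomial]
    simp +contextual
  have hre : r.eval₂ φ a = 0 := by
    have : g * r.eval₂ φ a = 0 := by
      rw [h1, hr, Polynomial.eval₂_finsetSum, Polynomial.sum, Finset.mul_sum]
      refine Finset.sum_congr rfl fun j _ => ?_
      rw [Polynomial.eval₂_monomial, hd]; ring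
    exact (mul_eq_zero.1 this).resolve_left hg
  set q := Polynomial.C p.leadingCoeff * r - Polynomial.C (δ p.leadingCoeff) * p with hq
  have hqc : ∀ j, q.coeff j = p.leadingCoeff * δ (p.coeff j) - δ p.leadingCoeff * p.coeff j := by
    intro j; simp [hq, hrc]
  have hq0 : q = 0 := by
    by_contra hne
    have h2 := hm q hne (by simp [hq, hre, hp])
    have h3 : q.natDegree ≤ p.natDegree := by
      rw [Polynomial.natDegree_le_iff_coeff_eq_zero]
      intro N hN
      rw [hqc, Polynomial.coeff_eq_zero_of_natDegree_lt hN]; simp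
    have h4 : q.coeff q.natDegree = 0 := by
      rw [le_antisymm h3 h2, hqc, Polynomial.coeff_natDegree]; ring
    exact hne (by simpa using h4)
  have := hqc j
  rw [hq0, Polynomial.coeff_zero] at this
  linear_combination -this

theorem aux_exmin {A B : Type*} [CommRing A] [CommRing B] (φ : B →+* A) (a : A)
    (h : ∃ p : Polynomial B, p ≠ 0 ∧ p.eval₂ φ a = 0) :
    ∃ p : Polynomial B, p ≠ 0 ∧ p.eval₂ φ a = 0 ∧
      ∀ q : Polynomial B, q ≠ 0 → q.eval₂ φ a = 0 → p.natDegree ≤ q.natDegree := by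
  classical
  have h' : ∃ n, ∃ p : Polynomial B, p ≠ 0 ∧ p.eval₂ φ a = 0 ∧ p.natDegree = n := by
    obtain ⟨p, h1, h2⟩ := h
    exact ⟨_, p, h1, h2, rfl⟩
  obtain ⟨p, h1, h2, h3⟩ := Nat.find_spec h'
  exact ⟨p, h1, h2, fun q h4 h5 => h3 ▸ Nat.find_min' h' ⟨q, h4, h5, rfl⟩⟩

/-- diagonal derivation -/
theorem aux_diag {ι S : Type*} [LinearOrder ι] [Finite ι] [CommRing S] [IsDomain S]
    (δ : MvPolynomial ι S →ₗ[S] MvPolynomial ι S) (Λ : (ι →₀ ℕ) → S) (hΛ : Function.Injective Λ)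
    (hδ : ∀ u α, coeff α (δ u) = Λ α * coeff α u)
    (u v : MvPolynomial ι S) (hv : v ≠ 0) (h : v * δ u = u * δ v) :
    ∃ s t : S, t ≠ 0 ∧ C t * u = C s * v := by
  let m : MonomialOrder ι := MonomialOrder.lex
  have hdeg : ∀ u, m.toSyn (m.degree (δ u)) ≤ m.toSyn (m.degree u) := by
    intro u
    apply m.degree_le_degree_of_support_subset
    intro α
    simp only [mem_support_iff, hδ]
    exact right_ne_zero_of_mul
  have key : ∀ u, u ≠ 0 → v * δ u = u * δ v → m.degree u = m.degree v := by
    intro u hu h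
    have h1 := congrArg (coeff (m.degree u + m.degree v)) h
    rw [m.coeff_mul_of_add_of_degree_le le_rfl (hdeg v), add_comm,
      m.coeff_mul_of_add_of_degree_le le_rfl (hdeg u), hδ, hδ] at h1
    have hu' := (m.coeff_degree_ne_zero_iff (f := u)).2 hu
    have hv' := (m.coeff_degree_ne_zero_iff (f := v)).2 hv
    apply hΛ
    apply mul_left_cancel₀ (mul_ne_zero hu' hv')
    linear_combination h1
  refine ⟨coeff (m.degree v) u, coeff (m.degree v) v, m.coeff_degree_ne_zero_iff.2 hv, ?_⟩
  set t := coeff (m.degree v) v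
  set s := coeff (m.degree v) u
  by_contra hne
  have hne' : C t * u - C s * v ≠ 0 := sub_ne_zero.2 hne
  have h2 := key _ hne' (by
    rw [← smul_eq_C_mul, ← smul_eq_C_mul, map_sub, map_smul, map_smul, smul_eq_C_mul, smul_eq_C_mul, smul_eq_C_mul, smul_eq_C_mul]
    linear_combination C t * h)
  have h3 := m.coeff_degree_ne_zero_iff.2 hne'
  rw [h2] at h3
  apply h3
  simp [s, t, coeff_C_mul]; ring

theorem aux_delta {ι S : Type*} [CommRing S] (l : ι → S) (u : MvPolynomial ι S)
    (α : ι →₀ ℕ) : coeff α (mkDerivation S (fun i => l i • (X i : MvPolynomial ι S)) u) =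
      (α.sum fun i m => (m : S) * l i) * coeff α u := by
  classical
  induction u using MvPolynomial.induction_on' with
  | add p q hp hq => simp only [map_add, coeff_add, hp, hq, mul_add]
  | monomial s c =>
    have : mkDerivation S (fun i => l i • (X i : MvPolynomial ι S)) (monomial s c)
        = monomial s ((s.sum fun i m => (m : S) * l i) * c) := by
      rw [mkDerivation_monomial, Finsupp.sum, Finsupp.sum, Finset.sum_mul, map_sum, Finset.smul_sum]
      refine Finset.sum_congr rfl fun i hi => ?_
      have e : s - Finsupp.single i 1 + Finsupp.single i 1 = s := by
        apply tsub_add_cancel_of_le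
        simpa [Finsupp.single_le_iff] using Nat.one_le_iff_ne_zero.2 (Finsupp.mem_support_iff.1 hi)
      rw [smul_eq_mul, mul_smul_comm, X, monomial_mul, e, smul_monomial, smul_monomial]
      simp; ring_nf
    rw [this, coeff_monomial, coeff_monomial]
    split_ifs with h
    · rw [h]
    · simp

theorem aux_aeval {k A : Type*} [Field k] [CommRing A] [Algebra k A]
    (E : Derivation k A A) (a : A) (p : Polynomial k) :
    E (Polynomial.aeval a p) = Polynomial.aeval a p.derivative * E a := by
  have := aux_eval E (algebraMap k A) a p
  simpa [Polynomial.sum, Polynomial.aeval_def] using this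

theorem aux_gcd {A ι : Type*} [CommRing A] [IsDomain A] [UniqueFactorizationMonoid A] [Fintype ι]
    (F : ι → A) (hF : ∀ e, (∀ i, e ∣ F i) → IsUnit e) (x g : A) (h : ∀ i, x ∣ g * F i) : x ∣ g := by
  classical
  let _ : NormalizedGCDMonoid A := Classical.choice inferInstance
  have h1 : x ∣ Finset.univ.gcd fun i => g * F i := Finset.dvd_gcd fun i _ => h i
  have h2 := h1.trans (Finset.gcd_mul_left' (s := Finset.univ) (f := F) g).dvd
  have h3 : IsUnit (Finset.univ.gcd F) := hF _ fun i => Finset.gcd_dvd (Finset.mem_univ i)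
  exact (h3.dvd_mul_right).1 h2

theorem aux_comm {k σ : Type*} [Field k] (i j : σ) (P : MvPolynomial σ k) :
    pderiv i (pderiv j P) = pderiv j (pderiv i P) := by
  classical
  have : ⁅(pderiv i : Derivation k (MvPolynomial σ k) (MvPolynomial σ k)),
      (pderiv j : Derivation k (MvPolynomial σ k) (MvPolynomial σ k))⁆ = 0 := by
    apply MvPolynomial.derivation_ext
    intro l
    rw [Derivation.commutator_apply, pderiv_X, pderiv_X]
    simp [Pi.single_apply, apply_ite]
  have h := congrArg (fun D => D P) this
  simpa [Derivation.commutator_apply, sub_eq_zero] using h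

theorem aux_core {k : Type*} [Field k] [CharZero k] {n : ℕ} (f : MvPolynomial (Fin n) k)
    (hF : ∀ e, (∀ i, e ∣ pderiv i f) → IsUnit e) (i0 : Fin n) (h0 : pderiv i0 f ≠ 0) (N : ℕ) :
    ∀ a : MvPolynomial (Fin n) k, a.totalDegree < N →
    (∀ i, pderiv i0 f * pderiv i a = pderiv i f * pderiv i0 a) → a ∈ Algebra.adjoin k {f} := by
  induction N with
  | zero => intro a h; omega
  | succ N ih =>
    intro a hN ha
    obtain ⟨b, hb⟩ : pderiv i0 f ∣ pderiv i0 a := by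
      apply aux_gcd _ hF
      intro i
      exact ⟨pderiv i a, by rw [ha]; ring⟩
    have hb' : ∀ i, pderiv i a = pderiv i f * b := by
      intro i
      apply mul_left_cancel₀ h0
      rw [ha, hb]; ring
    have hbm : b ∈ Algebra.adjoin k {f} := by
      by_cases hb0 : b = 0
      · rw [hb0]; exact zero_mem _
      apply ih
      · have h1 : pderiv i0 a ≠ 0 := by rw [hb]; exact mul_ne_zero h0 hb0
        have h2 := aux_deg _ _ h1
        rw [hb, totalDegree_mul_of_isDomain h0 hb0] at h2
        omega
      · intro i
        have h1 := aux_comm i i0 a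
        rw [hb' i0, hb' i, pderiv_mul, pderiv_mul, aux_comm i i0 f] at h1
        linear_combination h1
    rw [Algebra.adjoin_singleton_eq_range_aeval] at hbm ⊢
    obtain ⟨p, hp⟩ := hbm
    obtain ⟨q, hq⟩ : ∃ q : Polynomial k, q.derivative = p := by
      refine ⟨p.sum fun j c => Polynomial.monomial (j + 1) (c / (j + 1)), ?_⟩
      rw [Polynomial.sum, Polynomial.derivative_sum]
      conv_rhs => rw [p.as_sum_support]
      refine Finset.sum_congr rfl fun j _ => ?_
      rw [Polynomial.derivative_monomial]
      have : (j : k) + 1 ≠ 0 := by exact_mod_cast Nat.succ_ne_zero j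
      simp [this]
    obtain ⟨c, hc⟩ := aux_const (a - Polynomial.aeval f q) (by
      intro i
      rw [map_sub, hb', aux_aeval, hq, ← hp]
      simp; ring)
    refine ⟨q + Polynomial.C c, ?_⟩
    have : a = Polynomial.aeval f q + C c := by rw [← hc]; ring
    simp [this, algebraMap_eq]

theorem aux_inj {k : Type*} [Field k] [CharZero k] {n : ℕ} (f : MvPolynomial (Fin n) k)
    (i0 : Fin n) (h0 : pderiv i0 f ≠ 0) (y : Option {i : Fin n // i ≠ i0} → MvPolynomial (Fin n) k)
    (hy0 : y none = f) (hy : ∀ i, y (some i) = X i.1) : AlgebraicIndependent k y := by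
  classical
  have main : ∀ N, ∀ P : MvPolynomial (Option {i : Fin n // i ≠ i0}) k, P.totalDegree < N →
      aeval y P = 0 → P = 0 := by
    intro N
    induction N with
    | zero => intro a h; omega
    | succ N ih =>
      intro P hN hP
      have hn : aeval y (pderiv none P) = 0 := by
        have := aux_chain_s18 (pderiv i0) y P
        rw [hP, map_zero, Fintype.sum_option, hy0, Finset.sum_eq_zero, add_zero] at this
        · exact (mul_eq_zero.1 this.symm).resolve_right h0
        · intro i _
          rw [hy, pderiv_X_of_ne i.2, mul_zero]
      have hs : ∀ i, aeval y (pderiv (some i) P) = 0 := by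
        intro i
        have := aux_chain_s18 (pderiv i.1) y P
        rw [hP, map_zero, Fintype.sum_option, hn, Finset.sum_eq_single i, hy, pderiv_X_self] at this
        · simpa using this.symm
        · intro j _ hj
          rw [hy, pderiv_X_of_ne (fun h => hj (Subtype.ext h)), mul_zero]
        · simp
      have hz : ∀ j, pderiv j P = 0 := by
        intro j
        by_contra hne
        refine hne (ih _ (lt_of_lt_of_le (aux_deg _ _ hne) (Nat.lt_succ_iff.1 hN)) ?_)
        cases j with
        | none => exact hn
        | some i => exact hs i
      obtain ⟨c, rfl⟩ := aux_const P hz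
      simpa using hP
  rw [algebraicIndependent_iff]
  exact fun P hP => main _ P (Nat.lt_succ_self _) hP

theorem aux_lam {k : Type*} [Field k] [CharZero k] {ι : Type*} [Finite ι] (e : ι → ℕ)
    (he : Function.Injective e) : Function.Injective
    (fun α : ι →₀ ℕ => α.sum fun i m => (m : Polynomial k) * Polynomial.X ^ e i) := by
  classical
  have : ∀ (α : ι →₀ ℕ) (i : ι), (α.sum fun i m =>
      (m : Polynomial k) * Polynomial.X ^ e i).coeff (e i) = (α i : k) := by
    intro α i
    rw [Finsupp.sum, Polynomial.finsetSum_coeff, Finset.sum_eq_single i]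
    · rw [← Polynomial.C_eq_natCast, Polynomial.coeff_C_mul_X_pow, if_pos rfl]
    · intro j _ hj
      rw [← Polynomial.C_eq_natCast, Polynomial.coeff_C_mul_X_pow, if_neg]
      exact fun h => hj (he h.symm)
    · intro h
      simp [Finsupp.notMem_support_iff.1 h]
  intro α β h
  ext i
  have h1 := congrArg (fun p => Polynomial.coeff p (e i)) h
  simp only [this] at h1
  exact_mod_cast h1

theorem aux_main {k : Type*} [Field k] [CharZero k] {n : ℕ} (f : MvPolynomial (Fin n) k)
    (i0 : Fin n) (h0 : pderiv i0 f ≠ 0) (D : Fin n → Derivation k (MvPolynomial (Fin n) k) (MvPolynomial (Fin n) k))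
    (hD : ∀ i a, D i a = pderiv i0 f * pderiv i a - pderiv i f * pderiv i0 a) :
    ∃ d : Derivation k (MvPolynomial (Fin n) k) (MvPolynomial (Fin n) k), d f = 0 ∧
      ∀ a, d a = 0 → ∀ i, D i a = 0 := by
  classical
  let ι := {i : Fin n // i ≠ i0}
  let y : Option ι → MvPolynomial (Fin n) k := fun o => o.elim f (fun i => X i.1)
  have hai : AlgebraicIndependent k y := aux_inj f i0 h0 y rfl fun _ => rfl
  let e := optionEquivRight k ι
  let φ : MvPolynomial ι (Polynomial k) →ₐ[k] MvPolynomial (Fin n) k := (aeval y).comp e.symm.toAlgHom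
  have hφ : Function.Injective φ := Function.Injective.comp (f := e.symm)
    (show Function.Injective (aeval y : MvPolynomial (Option ι) k →ₐ[k] _) from hai) e.symm.injective
  have hφX : ∀ i, φ (X i) = X i.1 := by
    intro i
    have : e.symm (X i) = X (some i) := by
      rw [AlgEquiv.symm_apply_eq]; simp [e]
    simp [φ, this, y]
  have hφT : φ (C Polynomial.X) = f := by
    have : e.symm (C Polynomial.X) = X none := by
      rw [AlgEquiv.symm_apply_eq]; simp [e]
    simp [φ, this, y]
  have hφC : ∀ p : Polynomial k, φ (C p) = Polynomial.aeval f p := by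
    intro p
    have : (φ.comp (Algebra.algHom k (Polynomial k) (MvPolynomial ι (Polynomial k)))) = Polynomial.aeval f := by
      apply Polynomial.algHom_ext
      simp only [AlgHom.comp_apply, Polynomial.aeval_X]
      exact hφT
    exact congrArg (fun g => g p) this
  have hDf : ∀ i, D i f = 0 := by intro i; rw [hD]; ring
  have hDp : ∀ (i : Fin n) (p : Polynomial k), D i (Polynomial.aeval f p) = 0 := by
    intro i p; rw [aux_aeval, hDf, mul_zero]
  let d : Derivation k (MvPolynomial (Fin n) k) (MvPolynomial (Fin n) k) :=
    ∑ i : ι, (X i.1 * f ^ (i.1 : ℕ)) • D i.1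
  have hd : ∀ a, d a = ∑ i : ι, (X i.1 * f ^ (i.1 : ℕ)) * D i.1 a := by
    intro a
    have := congrFun (map_sum Derivation.coeFnAddMonoidHom
      (fun i : ι => (X i.1 * f ^ (i.1 : ℕ)) • D i.1) Finset.univ) a
    refine this.trans ?_
    rw [Finset.sum_apply]
    rfl
  let l : ι → Polynomial k := fun i => Polynomial.X ^ (i.1 : ℕ)
  let δ := mkDerivation (Polynomial k) (fun i => l i • (X i : MvPolynomial ι (Polynomial k)))
  have hdφ : ∀ u, d (φ u) = pderiv i0 f * φ (δ u) := by
    intro u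
    induction u using MvPolynomial.induction_on with
    | C p =>
      rw [hφC, hd]
      have : δ (C p) = 0 := δ.map_algebraMap p
      simp [hDp, this]
    | add p q hp hq => simp only [map_add, hp, hq, mul_add]
    | mul_X p i hp =>
      have h1 : d (φ (X i)) = pderiv i0 f * φ (δ (X i)) := by
        rw [hφX, hd, Finset.sum_eq_single i]
        · rw [hD, pderiv_X_self, pderiv_X_of_ne i.2, mkDerivation_X, smul_eq_C_mul, map_mul, hφC, hφX]
          simp [l]; ring
        · intro j _ hj
          rw [hD, pderiv_X_of_ne i.2, pderiv_X_of_ne (fun h => hj (Subtype.ext h.symm))]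
          simp
        · simp
      rw [map_mul, Derivation.leibniz, h1, hp, Derivation.leibniz]
      simp only [smul_eq_mul, map_add, map_mul]
      ring
  refine ⟨d, by rw [hd]; simp [hDf], fun a ha i => ?_⟩
  have halg : ∃ p : Polynomial (MvPolynomial ι (Polynomial k)), p ≠ 0 ∧ p.eval₂ φ.toRingHom a = 0 := by
    have hb : IsTranscendenceBasis k y := by
      apply hai.isTranscendenceBasis_of_lift_trdeg_le
      · rw [MvPolynomial.trdeg_of_isDomain]; simp
      · rw [MvPolynomial.trdeg_of_isDomain]
        have : n = Fintype.card ι + 1 := by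
          have := i0.pos
          simp [ι]; omega
        have h2 : Cardinal.mk (Option ι) = n := by
          rw [Cardinal.mk_fintype, Fintype.card_option, ← this]
        rw [h2]
        simp
    have h1 := hb.isAlgebraic
    obtain ⟨q, hq0, hq⟩ := h1.isAlgebraic a
    have hr : ∀ b ∈ Algebra.adjoin k (Set.range y), ∃ u, φ u = b := by
      intro b hb
      have : b ∈ (aeval y : MvPolynomial (Option ι) k →ₐ[k] _).range := by
        rwa [← Algebra.adjoin_range_eq_range_aeval]
      obtain ⟨u, hu⟩ := this
      exact ⟨e u, by simp [φ]; exact hu⟩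
    choose! s hs using hr
    refine ⟨∑ j ∈ q.support, Polynomial.monomial j (s (q.coeff j)), ?_, ?_⟩
    · obtain ⟨j, hj⟩ := Polynomial.support_nonempty.2 hq0
      intro hc
      have := congrArg (fun p => Polynomial.coeff p j) hc
      simp only [Polynomial.finsetSum_coeff, Polynomial.coeff_monomial, Polynomial.coeff_zero,
        Finset.sum_ite_eq', if_pos hj] at this
      have h2 := hs _ (q.coeff j).2
      rw [this, map_zero] at h2
      exact Polynomial.mem_support_iff.1 hj (Subtype.ext h2.symm)
    · rw [Polynomial.eval₂_finsetSum, ← hq, Polynomial.aeval_def, Polynomial.eval₂_eq_sum, Polynomial.sum]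
      refine Finset.sum_congr rfl fun j _ => ?_
      rw [Polynomial.eval₂_monomial]
      congr 1
      exact hs _ (q.coeff j).2
  obtain ⟨p, hp0, hp, hm⟩ := aux_exmin _ _ halg
  refine aux_min (D i) φ.toRingHom hφ a p hp0 hp hm fun j => ?_
  have h1 := aux_min2 d φ.toRingHom δ.toLinearMap.toAddMonoidHom _ h0 hdφ a ha p hp hm j
  have hl : p.leadingCoeff ≠ 0 := by simpa using hp0
  obtain ⟨s, t, ht, hst⟩ := aux_diag δ.toLinearMap _ (aux_lam (k := k) (fun i : ι => (i.1 : ℕ))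
    (fun i j h => Subtype.ext (Fin.ext h))) (fun u α => aux_delta l u α) _ _ hl h1
  have h2 := congrArg φ hst
  rw [map_mul, map_mul, hφC, hφC] at h2
  have ht' : Polynomial.aeval f t ≠ 0 := by
    rw [← hφC, Ne, map_eq_zero_iff φ hφ]; simpa using ht
  have h3 := congrArg (D i) h2
  rw [Derivation.leibniz, Derivation.leibniz, hDp, hDp] at h3
  simp only [smul_eq_mul, mul_zero, add_zero] at h3
  apply mul_left_cancel₀ ht'
  change _ * (φ _ * (D i) (φ _)) = _ * (φ _ * D i (φ _))
  linear_combination φ p.leadingCoeff * h3 - D i (φ p.leadingCoeff) * h2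

theorem statement18 {k : Type*} [Field k] [CharZero k] {n : ℕ}
    (f : MvPolynomial (Fin n) k)
    (h : ∃ c : k, c ≠ 0 ∧
      (∀ i : Fin n, C c ∣ pderiv i f) ∧
      ∀ e : MvPolynomial (Fin n) k, (∀ i : Fin n, e ∣ pderiv i f) → e ∣ C c) :
    (∀ a : MvPolynomial (Fin n) k,
      IsAlgebraic (Algebra.adjoin k {f}) a → a ∈ Algebra.adjoin k {f}) ∧
    ∃ d : Derivation k (MvPolynomial (Fin n) k) (MvPolynomial (Fin n) k),
      ∀ a : MvPolynomial (Fin n) k, a ∈ Algebra.adjoin k {f} ↔ d a = 0 := by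
  obtain ⟨c, hc, -, h⟩ := h
  have hF : ∀ e, (∀ i, e ∣ pderiv i f) → IsUnit e := fun e he =>
    isUnit_of_dvd_unit (h e he) ((IsUnit.mk0 c hc).map C)
  obtain ⟨i0, h0⟩ : ∃ i0, pderiv i0 f ≠ 0 := by
    by_contra! hz
    exact not_isUnit_zero (hF 0 fun i => by rw [hz])
  let D : Fin n → Derivation k (MvPolynomial (Fin n) k) (MvPolynomial (Fin n) k) :=
    fun i => pderiv i0 f • pderiv i - pderiv i f • pderiv i0
  have hD : ∀ i a, D i a = pderiv i0 f * pderiv i a - pderiv i f * pderiv i0 a := fun i a => by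
    simp [D]
  have core : ∀ a, (∀ i, D i a = 0) → a ∈ Algebra.adjoin k {f} := fun a ha =>
    aux_core f hF i0 h0 _ a (Nat.lt_succ_self _) fun i => sub_eq_zero.1 (by rw [← hD, ha])
  have kill : ∀ d : Derivation k (MvPolynomial (Fin n) k) (MvPolynomial (Fin n) k), d f = 0 →
      ∀ a ∈ Algebra.adjoin k {f}, d a = 0 := by
    intro d hd a ha
    rw [Algebra.adjoin_singleton_eq_range_aeval] at ha
    obtain ⟨p, rfl⟩ := ha
    change d (Polynomial.aeval f p) = 0
    rw [aux_aeval, hd, mul_zero]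
  refine ⟨fun a ha => core a fun i => ?_, ?_⟩
  · obtain ⟨p, hp0, hp, hm⟩ := aux_exmin (algebraMap (Algebra.adjoin k {f}) _) a ha
    have hk := kill (D i) (by rw [hD]; ring)
    refine aux_min (D i) _ Subtype.val_injective a p hp0 hp hm fun j => ?_
    have h1 : ∀ b : Algebra.adjoin k {f}, D i (algebraMap _ (MvPolynomial (Fin n) k) b) = 0 :=
      fun b => hk _ b.2
    rw [h1, h1, mul_zero, mul_zero]
  · obtain ⟨d, hdf, hd⟩ := aux_main f i0 h0 D hD
    exact ⟨d, fun a => ⟨kill d hdf a, fun ha => core a (hd a ha)⟩⟩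
end
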